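/- (Theorem 3, net zero zone) Let Δ⁺ := Σ_i l_i(π⁺) and Δ⁻ := Σ_i l_i(π⁻). If Δ⁺ ≤ r ≤ Δ⁻, then there exists ν ∈ [π⁻, π⁺] such that Σ_i l_i(ν) = r and the consumption vector d* with d*_i = l_i(ν) for every i = 1,…,K is a maximizer of the surplus S(d) over d ∈ ∏_i [0, d̄_i] (the prosumer consumes exactly its renewable generation). -/

import Mathlib

open Set

/-- **Theorem 3, net zero zone.**
If `Δ⁺ ≤ r ≤ Δ⁻` (with `Δ⁺ = ∑ i, l i π⁺`, `Δ⁻ = ∑ i, l i π⁻`), then there exists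
`ν ∈ [π⁻, π⁺]` with `∑ i, l i ν = r` such that `d*` with `d*_i = l_i(ν)` maximizes
the prosumer surplus `S` over `∏ i [0, d̄_i]`: the prosumer consumes exactly its
renewable generation. -/
theorem theorem3_net_zero_zone
    (K : ℕ) (dbar : Fin K → ℝ) (hdbar : ∀ i, 0 < dbar i)
    (U : Fin K → ℝ → ℝ)
    (hUconc : ∀ i, StrictConcaveOn ℝ (Icc 0 (dbar i)) (U i))
    (hUmono : ∀ i, StrictMonoOn (U i) (Icc 0 (dbar i)))
    (hUzero : ∀ i, U i 0 = 0)
    -- `L i` is the (continuous) marginal utility `U_i'` on `[0, d̄_i]`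
    (L : Fin K → ℝ → ℝ)
    (hL : ∀ i, ∀ x ∈ Icc 0 (dbar i), HasDerivWithinAt (U i) (L i x) (Icc 0 (dbar i)) x)
    (hLcont : ∀ i, ContinuousOn (L i) (Icc 0 (dbar i)))
    -- `l i π = max {0, min {d̄_i, L_i⁻¹(π)}}`, characterized by clipping
    (l : Fin K → ℝ → ℝ)
    (hl_mem : ∀ i π, l i π ∈ Icc 0 (dbar i))
    (hl_hi : ∀ i π, π ≤ L i (dbar i) → l i π = dbar i)
    (hl_lo : ∀ i π, L i 0 ≤ π → l i π = 0)
    (hl_mid : ∀ i π, L i (dbar i) < π → π < L i 0 → L i (l i π) = π)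
    -- NEM X prices with `π⁺ ≥ π⁻ > 0`
    (πp πm : ℝ) (hπ : πm ≤ πp) (hπm : 0 < πm)
    -- renewable generation
    (r : ℝ) (hr : 0 ≤ r)
    -- prosumer surplus
    (S : (Fin K → ℝ) → ℝ)
    (hS : ∀ d, S d = ∑ i, U i (d i) -
      (πp * max (∑ i, d i - r) 0 - πm * max (-(∑ i, d i - r)) 0))
    -- net zero zone
    (hzone₁ : (∑ i, l i πp) ≤ r) (hzone₂ : r ≤ ∑ i, l i πm) :
    ∃ ν ∈ Icc πm πp,
      (∑ i, l i ν) = r ∧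
      IsMaxOn S {d | ∀ i, d i ∈ Icc 0 (dbar i)} (fun i => l i ν) := by
  have grad : ∀ i, ∀ x ∈ Icc 0 (dbar i), ∀ y ∈ Icc 0 (dbar i), x ≠ y →
      U i x < U i y + L i y * (x - y) := by
    intro i x hx y hy hxy
    rcases lt_or_gt_of_ne hxy with h | h
    · have := (hUconc i).lt_slope_of_hasDerivWithinAt hx hy h (hL i y hy)
      rw [slope_def_field, lt_div_iff₀ (by linarith)] at this
      linarith
    · have := (hUconc i).slope_lt_of_hasDerivWithinAt hy hx h (hL i y hy)
      rw [slope_def_field, div_lt_iff₀ (by linarith)] at this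
      linarith
  have anti : ∀ i, ∀ x ∈ Icc 0 (dbar i), ∀ y ∈ Icc 0 (dbar i), x < y → L i y < L i x := by
    intro i x hx y hy hxy
    have h1 := grad i x hx y hy hxy.ne
    have h2 := grad i y hy x hx hxy.ne'
    by_contra! h
    nlinarith [mul_nonneg (sub_nonneg.2 h) (sub_pos.2 hxy).le]
  have h0 : ∀ i, (0:ℝ) ∈ Icc 0 (dbar i) := fun i => ⟨le_rfl, (hdbar i).le⟩
  have h1 : ∀ i, dbar i ∈ Icc 0 (dbar i) := fun i => ⟨(hdbar i).le, le_rfl⟩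
  have opt : ∀ i p, ∀ x ∈ Icc 0 (dbar i), U i x ≤ U i (l i p) + p * (x - l i p) := by
    intro i p x hx
    have hg : U i x ≤ U i (l i p) + L i (l i p) * (x - l i p) := by
      by_cases hxl : x = l i p
      · rw [← hxl]; simp
      · exact (grad i x hx _ (hl_mem i p) hxl).le
    have : (L i (l i p) - p) * (x - l i p) ≤ 0 := by
      by_cases ha : p ≤ L i (dbar i)
      · rw [hl_hi i p ha]
        exact mul_nonpos_of_nonneg_of_nonpos (by linarith) (by linarith [hx.2])
      · by_cases hb : L i 0 ≤ p
        · rw [hl_lo i p hb]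
          exact mul_nonpos_of_nonpos_of_nonneg (by linarith) (by linarith [hx.1])
        · rw [hl_mid i p (not_le.1 ha) (not_le.1 hb)]; simp
    linarith
  have lanti : ∀ i, Antitone (l i) := by
    intro i p q hpq
    rcases hpq.eq_or_lt with h | h
    · rw [h]
    · have e1 := opt i p _ (hl_mem i q)
      have e2 := opt i q _ (hl_mem i p)
      by_contra! hc
      nlinarith [mul_pos (sub_pos.2 h) (sub_pos.2 hc)]
  have lsurj : ∀ i, ∀ x ∈ Icc 0 (dbar i), l i (L i x) = x := by
    intro i x hx
    rcases hx.1.eq_or_lt with h | h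
    · rw [← h]; exact hl_lo i _ le_rfl
    rcases hx.2.eq_or_lt with h' | h'
    · rw [h']; exact hl_hi i _ le_rfl
    have e := hl_mid i (L i x) (anti i x hx _ (h1 i) h') (anti i _ (h0 i) x hx h)
    rcases lt_trichotomy (l i (L i x)) x with c | c | c
    · have := anti i _ (hl_mem i _) x hx c
      linarith
    · exact c
    · have := anti i x hx _ (hl_mem i _) c
      linarith
  have lcont : ∀ i, Continuous (l i) := by
    intro i
    let f : ℝ → Icc 0 (dbar i) := fun p => ⟨l i (-p), hl_mem i _⟩
    have hf : Continuous f := by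
      apply Monotone.continuous_of_surjective
      · intro p q hpq
        exact lanti i (neg_le_neg hpq)
      · rintro ⟨x, hx⟩
        refine ⟨-(L i x), Subtype.ext ?_⟩
        simp [f, lsurj i x hx]
    have := (continuous_subtype_val.comp hf).comp continuous_neg
    convert this using 1
    ext p
    simp [f]
  obtain ⟨ν, hν, hsum⟩ := intermediate_value_Icc' hπ
    (continuous_finsetSum Finset.univ (fun i _ => lcont i)).continuousOn ⟨hzone₁, hzone₂⟩
  refine ⟨ν, hν, hsum, ?_⟩
  intro d hd
  have hs : ∑ i, U i (d i) ≤ ∑ i, (U i (l i ν) + ν * (d i - l i ν)) :=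
    Finset.sum_le_sum fun i _ => opt i ν _ (hd i)
  simp only at hsum
  rw [Finset.sum_add_distrib, ← Finset.mul_sum, Finset.sum_sub_distrib, hsum] at hs
  show S d ≤ S _
  rw [hS, hS, hsum]
  simp only [sub_self, neg_zero, max_self, mul_zero, sub_zero]
  obtain ⟨ha, hb⟩ := hν
  rcases le_total 0 (∑ i, d i - r) with h | h
  · rw [max_eq_left h, max_eq_right (by linarith)]
    nlinarith
  · rw [max_eq_right h, max_eq_left (by linarith)]
    nlinarith
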